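/- arXiv:1705.04791 — 2 statements merged into one kernel-verified Lean document; each statement's English description precedes it below -/
import Mathlib

section
/- Let λ = (λ_1 ≥ ⋯ ≥ λ_r > 0) be a partition of length r ≤ n and define the factorial Schur polynomial s_λ(x_n|b) := Σ_{w∈C(r,n)} w·( ∏_{i=1}^{r} ∏_{j=1}^{λ_i−i+n} (x_i + b_j) / ∏_{i=1}^{r} ∏_{j=i+1}^{n} (x_i − x_j) ). Then s_λ(x_n|b) = [u_1^{−λ_1}⋯u_r^{−λ_r}]( ∏_{i=1}^{r} ( ∏_{j=1}^{n} u_i/(u_i − x_j) · ∏_{j=1}^{λ_i−i+n} (u_i + b_j)/u_i ) · ∏_{1≤i<j≤r} (u_j − u_i)/u_j ), the coefficient being taken in Λ. This is the additive specialization of the generating-function theorem for the universal factorial Schur functions of Kempf–Laksov type. -/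
open Finset

noncomputable section

/-- `Fin r` is well-founded under `<`. -/
instance finWF (r : ℕ) : WellFoundedLT (Fin r) :=
  inferInstanceAs (IsWellFounded (Fin r) (· < ·))

/-- The field `ℚ(x_1, …, x_n, b_1, b_2, …)` of rational functions. -/
abbrev K (n : ℕ) : Type := FractionRing (MvPolynomial (Fin n ⊕ ℕ) ℚ)

/-- The indeterminate `x_i` (`0`-indexed). -/
def x (n : ℕ) (i : Fin n) : K n :=
  algebraMap (MvPolynomial (Fin n ⊕ ℕ) ℚ) (K n) (MvPolynomial.X (Sum.inl i))

/-- The indeterminate `b_{j+1}` (so `b 0 = b_1`, `b 1 = b_2`, …). -/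
def b (n : ℕ) (j : ℕ) : K n :=
  algebraMap (MvPolynomial (Fin n ⊕ ℕ) ℚ) (K n) (MvPolynomial.X (Sum.inr j))

/-- The coset representatives `C(r,n)`: permutations `w` of `{0, …, n-1}` that are
strictly increasing on positions `r, r+1, …, n-1` (`0`-indexed). -/
def Cperm (r n : ℕ) : Finset (Equiv.Perm (Fin n)) :=
  Finset.univ.filter fun w => ∀ i j : Fin n, r ≤ (i : ℕ) → i < j → w i < w j

/-- The iterated formal Laurent series field
`Λ = K((u_1⁻¹))((u_2⁻¹))⋯((u_r⁻¹))`, realized inside the Hahn series field over the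
lexicographically ordered group `ℤ^r` (the coordinate of `u_r⁻¹` being the most significant). -/
abbrev H (n r : ℕ) := HahnSeries (Lex (Fin r → ℤ)) (K n)

/-- The variable `u_i` (`0`-indexed), i.e. the Hahn series `u_i = (u_i⁻¹)⁻¹`. -/
def u (n r : ℕ) (i : Fin r) : H n r :=
  HahnSeries.single (toLex (Pi.single (Fin.rev i) (-1 : ℤ))) 1

section LaurentSeries

/-- The coefficient of `t⁻¹` in `1 / (t - c)`, where `t⁻¹` is the uniformizer, is `1`. -/
theorem coeff_inv_single_sub_C {F : Type*} [Field F] (c : F) :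
    ((HahnSeries.single (-1 : ℤ) (1 : F) - HahnSeries.C c)⁻¹).coeff 1 = 1 := by
  set p : PowerSeries F := 1 - PowerSeries.C c * PowerSeries.X with hp
  have hp0 : PowerSeries.constantCoeff p ≠ 0 := by simp [hp]
  have hy : (HahnSeries.single (-1 : ℤ) (1 : F) - HahnSeries.C c)⁻¹ =
      HahnSeries.single (1 : ℤ) (1 : F) * HahnSeries.ofPowerSeries ℤ F p⁻¹ := by
    refine inv_eq_of_mul_eq_one_right ?_
    have h1 : (HahnSeries.single (-1 : ℤ) (1 : F) - HahnSeries.C c) *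
        HahnSeries.single (1 : ℤ) (1 : F) = HahnSeries.ofPowerSeries ℤ F p := by
      rw [hp, map_sub, map_mul, map_one (HahnSeries.ofPowerSeries ℤ F), HahnSeries.ofPowerSeries_C, HahnSeries.ofPowerSeries_X,
        sub_mul, HahnSeries.single_mul_single]
      simp
    rw [← mul_assoc, h1, ← map_mul, PowerSeries.mul_inv_cancel _ hp0, map_one]
  have h0 := HahnSeries.ofPowerSeries_apply_coeff (Γ := ℤ) p⁻¹ 0
  rw [Nat.cast_zero] at h0
  rw [hy, HahnSeries.coeff_single_mul, sub_self, h0]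
  simp [hp]

open Polynomial in
/-- A polynomial in `t` has no `t⁻¹` term. -/
theorem coeff_eval₂_single_neg_one {F : Type*} [Field F] (A : F[X]) :
    (A.eval₂ HahnSeries.C (HahnSeries.single (-1 : ℤ) (1 : F))).coeff 1 = 0 := by
  rw [Polynomial.eval₂_eq_sum_range, HahnSeries.coeff_sum]
  refine Finset.sum_eq_zero fun k _ => ?_
  rw [HahnSeries.single_pow, HahnSeries.C_mul_eq_smul, HahnSeries.coeff_smul,
    HahnSeries.coeff_single_of_ne, smul_zero]
  simp only [nsmul_eq_mul]
  omega

open Polynomial in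
/-- Sum of residues: the coefficient of `t⁻¹` in `P(t) / ∏ⱼ (t - xⱼ)`. -/
theorem coeff_eval₂_div_prod_sub {F : Type*} [Field F] {n : ℕ} (v : Fin n → F)
    (hv : Function.Injective v) (P : F[X]) :
    (P.eval₂ HahnSeries.C (HahnSeries.single (-1 : ℤ) (1 : F)) /
      ∏ j, (HahnSeries.single (-1 : ℤ) (1 : F) - HahnSeries.C (v j))).coeff 1 =
    ∑ k, P.eval (v k) / ∏ j ∈ univ.erase k, (v k - v j) := by
  set t : HahnSeries ℤ F := HahnSeries.single (-1 : ℤ) (1 : F) with ht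
  have hne : ∀ j, t - HahnSeries.C (v j) ≠ 0 := fun j h => by
    have := congrArg (fun f : HahnSeries ℤ F => f.coeff (-1)) h
    simp [ht, HahnSeries.C_apply] at this
  set Q := Lagrange.nodal univ v with hQ
  have hQm : Q.Monic := Lagrange.nodal_monic
  have hQt : Q.eval₂ HahnSeries.C t = ∏ j, (t - HahnSeries.C (v j)) := by
    simp [hQ, Lagrange.nodal_eq, eval₂_finsetProd]
  have hQ0 : ∏ j, (t - HahnSeries.C (v j)) ≠ 0 := prod_ne_zero_iff.2 fun j _ => hne j
  have hdeg : (P %ₘ Q).degree < #(univ : Finset (Fin n)) :=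
    (degree_modByMonic_lt P hQm).trans_eq Lagrange.degree_nodal
  have hev : ∀ i ∈ (univ : Finset (Fin n)), (P %ₘ Q).eval (v i) = P.eval (v i) := by
    intro i hi
    conv_rhs => rw [← modByMonic_add_div P Q]
    simp [hQ, Lagrange.eval_nodal_at_node hi]
  have hmod := Lagrange.eq_interpolate_of_eval_eq _ hv.injOn hdeg hev
  rw [Lagrange.interpolate_eq_sum] at hmod
  have hP : P.eval₂ HahnSeries.C t / ∏ j, (t - HahnSeries.C (v j)) =
      (∑ k, HahnSeries.C (P.eval (v k) / ∏ j ∈ univ.erase k, (v k - v j)) *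
        (t - HahnSeries.C (v k))⁻¹) + (P /ₘ Q).eval₂ HahnSeries.C t := by
    conv_lhs => rw [← modByMonic_add_div P Q]
    rw [eval₂_add, eval₂_mul, hQt, add_div, mul_div_cancel_left₀ _ hQ0, hmod, eval₂_finsetSum,
      Finset.sum_div]
    congr 1
    refine sum_congr rfl fun k _ => ?_
    rw [eval₂_mul, eval₂_C, mul_div_assoc]
    congr 1
    rw [eval₂_finsetProd, ← mul_prod_erase univ _ (mem_univ k)]
    simp only [eval₂_sub, eval₂_X, eval₂_C]
    rw [div_mul_cancel_right₀]
    exact prod_ne_zero_iff.2 fun j _ => hne j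
  rw [hP, HahnSeries.coeff_add, coeff_eval₂_single_neg_one, add_zero, HahnSeries.coeff_sum]
  refine sum_congr rfl fun k _ => ?_
  rw [HahnSeries.C_mul_eq_smul, HahnSeries.coeff_smul, coeff_inv_single_sub_C, smul_eq_mul, mul_one]

end LaurentSeries

section IteratedLaurent

/-- The inclusion of the `k`-th coordinate axis into the lexicographic product `ℤ^r`. -/
def lexSingle {r : ℕ} (k : Fin r) : ℤ →+ Lex (Fin r → ℤ) where
  toFun m := toLex (Pi.single k m)
  map_zero' := by simp
  map_add' a b := by simp [Pi.single_add]

theorem lexSingle_strictMono {r : ℕ} (k : Fin r) : StrictMono (lexSingle k) := by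
  intro a b hab
  refine ⟨k, fun j hj => ?_, ?_⟩
  · simp [lexSingle, hj.ne]
  · simpa [lexSingle] using hab

/-- Laurent series in the `k`-th variable, as iterated Laurent series. -/
def inVariable {r : ℕ} {F : Type*} [Field F] (k : Fin r) :
    HahnSeries ℤ F →+* HahnSeries (Lex (Fin r → ℤ)) F :=
  HahnSeries.embDomainRingHom (lexSingle k) (lexSingle_strictMono k).injective
    fun _ _ => (lexSingle_strictMono k).le_iff_le

theorem inVariable_single {r : ℕ} {F : Type*} [Field F] (k : Fin r) (m : ℤ) (c : F) :
    inVariable k (HahnSeries.single m c) = HahnSeries.single (toLex (Pi.single k m)) c :=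
  HahnSeries.embDomain_single

theorem inVariable_C {r : ℕ} {F : Type*} [Field F] (k : Fin r) (c : F) :
    inVariable k (HahnSeries.C c) = HahnSeries.C c :=
  HahnSeries.embDomainRingHom_C

theorem coeff_inVariable_single {r : ℕ} {F : Type*} [Field F] (k : Fin r) (g : HahnSeries ℤ F)
    (m : ℤ) : (inVariable k g).coeff (toLex (Pi.single k m)) = g.coeff m :=
  HahnSeries.embDomain_coeff (f := ⟨⟨lexSingle k, (lexSingle_strictMono k).injective⟩,
    (lexSingle_strictMono k).le_iff_le⟩)

theorem exists_of_coeff_inVariable_ne_zero {r : ℕ} {F : Type*} [Field F] (k : Fin r)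
    (g : HahnSeries ℤ F) (a : Lex (Fin r → ℤ)) (ha : (inVariable k g).coeff a ≠ 0) :
    ∃ m : ℤ, a = toLex (Pi.single k m) := by
  by_contra h
  refine ha (HahnSeries.embDomain_of_notMem_range ?_)
  rintro ⟨m, rfl⟩
  exact h ⟨m, rfl⟩

theorem coeff_prod_inVariable_finset {r : ℕ} {F : Type*} [Field F] (g : Fin r → HahnSeries ℤ F)
    (s : Finset (Fin r)) (a : Fin r → ℤ) :
    (∏ k ∈ s, inVariable k (g k)).coeff (toLex a) =
      if ∀ k ∉ s, a k = 0 then ∏ k ∈ s, (g k).coeff (a k) else 0 := by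
  induction s using Finset.induction_on generalizing a with
  | empty =>
    have : toLex a = 0 ↔ ∀ k, a k = 0 := by
      rw [← toLex_zero, toLex_inj, funext_iff]; rfl
    simp [HahnSeries.coeff_one, this]
  | insert i s hi ih =>
    rw [prod_insert hi, HahnSeries.coeff_mul]
    have hdecomp : a = Pi.single i (a i) + Function.update a i 0 := by
      ext j
      by_cases hj : j = i
      · subst hj; simp
      · simp [hj]
    have hcond : (∀ k ∉ s, Function.update a i 0 k = 0) ↔ ∀ k ∉ insert i s, a k = 0 := by
      constructor
      · intro h k hk
        rw [mem_insert, not_or] at hk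
        simpa [hk.1] using h k hk.2
      · intro h k hk
        by_cases hki : k = i
        · subst hki; simp
        · simpa [hki] using h k (by simp [hki, hk])
    have hprod : ∏ k ∈ s, (g k).coeff (Function.update a i 0 k) = ∏ k ∈ s, (g k).coeff (a k) :=
      prod_congr rfl fun k hk => by
        rw [Function.update_of_ne (ne_of_mem_of_not_mem hk hi)]
    rw [Finset.sum_eq_single
      (toLex (Pi.single i (a i)), toLex (Function.update a i 0))]
    · simp only [coeff_inVariable_single, ih, hcond, hprod, prod_insert hi, mul_ite, mul_zero]
    · rintro ⟨p, q⟩ hpq hne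
      by_contra h
      obtain ⟨m, rfl⟩ := exists_of_coeff_inVariable_ne_zero _ _ _ (left_ne_zero_of_mul h)
      have hq := right_ne_zero_of_mul h
      rw [← toLex_ofLex q, ih] at hq
      have hq0 : ofLex q i = 0 := by
        by_contra h0
        exact hq (if_neg fun hall => h0 (hall i hi))
      have hsum : Pi.single i m + ofLex q = a :=
        congrArg ofLex (Finset.mem_antidiagonal.1 hpq).2.2
      refine hne ?_
      have hm : a i = m := by simp [← hsum, hq0]
      rw [Prod.mk.injEq, hm]
      refine ⟨rfl, ?_⟩
      rw [hm, ← hsum] at hdecomp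
      rw [← hsum, ← add_left_cancel hdecomp, toLex_ofLex]
    · intro hnot
      by_contra h
      exact hnot (Finset.mem_antidiagonal.2
        ⟨left_ne_zero_of_mul h, right_ne_zero_of_mul h, (congrArg toLex hdecomp).symm⟩)

theorem coeff_prod_inVariable {r : ℕ} {F : Type*} [Field F] (g : Fin r → HahnSeries ℤ F)
    (a : Fin r → ℤ) :
    (∏ k, inVariable k (g k)).coeff (toLex a) = ∏ k, (g k).coeff (a k) := by
  simp [coeff_prod_inVariable_finset]

end IteratedLaurent

section CosetRepresentatives

theorem Cperm_tail_eq {r n : ℕ} (hrn : r ≤ n) {w : Equiv.Perm (Fin n)} (hw : w ∈ Cperm r n)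
    {s : Finset (Fin n)} (hs : s = (univ.image fun i => w (Fin.castLE hrn i))ᶜ)
    (hcard : s.card = n - r) (i : Fin (n - r)) :
    w ⟨r + i, by omega⟩ = s.orderEmbOfFin hcard i := by
  have := Finset.orderEmbOfFin_unique hcard (f := fun i : Fin (n - r) => w ⟨r + i, by omega⟩)
    (fun i => by
      subst hs
      simp only [mem_compl, mem_image, mem_univ, true_and, not_exists]
      intro j hj
      have := congrArg Fin.val (w.injective hj)
      simp at this
      omega)
    (fun i j hij => (mem_filter.1 hw).2 _ _ (Nat.le_add_right _ _)
      (Fin.lt_def.2 (Nat.add_lt_add_left hij r)))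
  exact congrFun this i

theorem card_compl_image_of_injective {r n : ℕ} {f : Fin r → Fin n} (hf : Function.Injective f) :
    ((univ.image f)ᶜ : Finset (Fin n)).card = n - r := by
  rw [card_compl, card_image_of_injective _ hf]; simp

theorem Cperm_restrict_injOn {r n : ℕ} (hrn : r ≤ n) :
    Set.InjOn (fun (w : Equiv.Perm (Fin n)) (i : Fin r) => w (Fin.castLE hrn i)) (Cperm r n) := by
  intro w hw w' hw' h
  have hinj : Function.Injective fun i => w (Fin.castLE hrn i) :=
    w.injective.comp (Fin.castLE_injective hrn)
  have hcard := card_compl_image_of_injective hinj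
  ext i : 1
  by_cases hi : (i : ℕ) < r
  · exact congrFun h ⟨i, hi⟩
  · have hiw : i = ⟨r + (⟨i - r, by omega⟩ : Fin (n - r)), by simp; omega⟩ := by
      ext; simp; omega
    rw [hiw, Cperm_tail_eq hrn hw rfl hcard,
      Cperm_tail_eq hrn hw' (congrArg (fun f => (univ.image f)ᶜ) h) hcard]

theorem exists_mem_Cperm_restrict_eq {r n : ℕ} (hrn : r ≤ n) {f : Fin r → Fin n}
    (hf : Function.Injective f) :
    ∃ w ∈ Cperm r n, (fun i => w (Fin.castLE hrn i)) = f := by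
  have hcard := card_compl_image_of_injective hf
  set e := ((univ.image f)ᶜ : Finset (Fin n)).orderEmbOfFin hcard with he
  have hmem : ∀ i j, e i ≠ f j := fun i j h => by
    have := Finset.orderEmbOfFin_mem _ hcard i
    rw [← he, h] at this
    simp at this
  let g : Fin n → Fin n := fun i => if h : (i : ℕ) < r then f ⟨i, h⟩ else e ⟨i - r, by omega⟩
  have hg : Function.Injective g := by
    intro i j hij
    simp only [g] at hij
    split_ifs at hij with h1 h2 h2
    · simpa [Fin.ext_iff] using hf hij
    · exact absurd hij.symm (hmem _ _)
    · exact absurd hij (hmem _ _)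
    · have := e.injective hij
      simp only [Fin.mk.injEq] at this
      ext
      omega
  refine ⟨Equiv.ofBijective g (Finite.injective_iff_bijective.1 hg), ?_, ?_⟩
  · refine mem_filter.2 ⟨mem_univ _, fun i j hi hij => ?_⟩
    have hj : r ≤ (j : ℕ) := hi.trans (Fin.lt_def.1 hij).le
    simp only [Equiv.ofBijective_apply, g, dif_neg (not_lt.2 hi), dif_neg (not_lt.2 hj)]
    refine e.strictMono ?_
    rw [Fin.lt_def] at hij ⊢
    simp only
    omega
  · ext i
    simp [g]

theorem sum_Cperm_eq_sum_fun {r n : ℕ} (hrn : r ≤ n) {M : Type*} [AddCommMonoid M]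
    (φ : (Fin r → Fin n) → M) (hφ : ∀ f, ¬ Function.Injective f → φ f = 0) :
    ∑ w ∈ Cperm r n, φ (fun i => w (Fin.castLE hrn i)) = ∑ f, φ f := by
  rw [← sum_image (f := φ) (Cperm_restrict_injOn hrn)]
  refine sum_subset (subset_univ _) fun f _ hf => hφ f fun hinj => hf ?_
  obtain ⟨w, hw, h⟩ := exists_mem_Cperm_restrict_eq hrn hinj
  exact mem_image.2 ⟨w, hw, h⟩

end CosetRepresentatives

section GeneratingFunction

/-- The Vandermonde factor of the generating function. -/
theorem prod_Ioi_sub_div {F : Type*} [Field F] {r : ℕ} (y : Fin r → F) :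
    ∏ i, ∏ j ∈ Ioi i, (y j - y i) / y j =
      ∑ σ : Equiv.Perm (Fin r), (Equiv.Perm.sign σ : F) * ∏ i, y i ^ (σ i : ℕ) / y i ^ (i : ℕ) := by
  have hden : ∏ i, ∏ j ∈ Ioi i, y j = ∏ j, y j ^ (j : ℕ) := by
    rw [prod_comm' (t' := univ) (s' := fun j => Iio j) (by simp)]
    exact prod_congr rfl fun j _ => by rw [prod_const, Fin.card_Iio]
  simp_rw [prod_div_distrib]
  rw [hden, ← Matrix.det_vandermonde, ← Matrix.det_transpose, Matrix.det_apply', sum_div]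
  exact sum_congr rfl fun σ _ => by simp [Matrix.vandermonde_apply, mul_div_assoc]

open Polynomial in
/-- The part of the generating function that involves a single variable `t`, up to the
contribution `t ^ m` of the Vandermonde determinant. -/
theorem prod_div_mul_prod_div_mul_pow_div {F : Type*} [Field F] {n N i l m : ℕ} (v : Fin n → F)
    (β : ℕ → F) (hN : N + i + 1 = l + n) :
    (∏ j, HahnSeries.single (-1 : ℤ) (1 : F) /
        (HahnSeries.single (-1 : ℤ) (1 : F) - HahnSeries.C (v j))) *
      (∏ j ∈ range N, (HahnSeries.single (-1 : ℤ) (1 : F) + HahnSeries.C (β j)) /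
        HahnSeries.single (-1 : ℤ) (1 : F)) *
      (HahnSeries.single (-1 : ℤ) (1 : F) ^ m / HahnSeries.single (-1 : ℤ) (1 : F) ^ i) =
    ((∏ j ∈ range N, (X + C (β j))) * X ^ m).eval₂ HahnSeries.C
        (HahnSeries.single (-1 : ℤ) (1 : F)) /
      (∏ j, (HahnSeries.single (-1 : ℤ) (1 : F) - HahnSeries.C (v j))) *
      HahnSeries.single ((l : ℤ) - 1) (1 : F) := by
  have hs : HahnSeries.single ((l : ℤ) - 1) (1 : F) =
      HahnSeries.single (-1 : ℤ) (1 : F) / HahnSeries.single (-1 : ℤ) (1 : F) ^ l := by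
    rw [eq_div_iff (pow_ne_zero _ (by simp)), HahnSeries.single_pow, HahnSeries.single_mul_single]
    have hl : (l : ℤ) - 1 + -l = -1 := by ring
    simp [hl]
  have ht : HahnSeries.single (-1 : ℤ) (1 : F) ≠ 0 := by simp
  rw [hs]
  generalize HahnSeries.single (-1 : ℤ) (1 : F) = t at ht ⊢
  simp only [prod_div_distrib, prod_const, card_univ, Fintype.card_fin, card_range, eval₂_mul,
    eval₂_finsetProd, eval₂_add, eval₂_X, eval₂_C, eval₂_pow]
  have key : t ^ n / t ^ N / t ^ i = t / t ^ l := by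
    rw [div_div, ← pow_add, div_eq_div_iff (pow_ne_zero _ ht) (pow_ne_zero _ ht), ← pow_add,
      ← pow_succ', hN, add_comm]
  rw [← key]
  ring

/-- The denominator of a summand of the Schur polynomial times a Vandermonde product is the product
of the residue denominators. -/
theorem prod_Ioi_sub_mul_prod_Iio_sub {F : Type*} [Field F] {r n : ℕ} (hrn : r ≤ n)
    (v : Fin n → F) (w : Equiv.Perm (Fin n)) :
    (∏ i : Fin r, ∏ j ∈ Ioi (Fin.castLE hrn i), (v (w (Fin.castLE hrn i)) - v (w j))) *
      (∏ i : Fin r, ∏ j ∈ Ioi i, (v (w (Fin.castLE hrn j)) - v (w (Fin.castLE hrn i)))) =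
    ∏ i : Fin r, ∏ k ∈ univ.erase (w (Fin.castLE hrn i)), (v (w (Fin.castLE hrn i)) - v k) := by
  rw [prod_comm' (s := univ) (t := fun i : Fin r => Ioi i) (t' := univ) (s' := fun j => Iio j)
    (by simp), ← prod_mul_distrib]
  refine prod_congr rfl fun i _ => ?_
  have hIio : ∏ j ∈ Iio i, (v (w (Fin.castLE hrn i)) - v (w (Fin.castLE hrn j))) =
      ∏ j ∈ Iio (Fin.castLE hrn i), (v (w (Fin.castLE hrn i)) - v (w j)) := by
    refine prod_nbij (Fin.castLE hrn) (by simp) (Fin.castLE_injective hrn).injOn ?_ (by simp)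
    intro j hj
    have hji : (j : ℕ) < i := by simpa [Fin.lt_def] using hj
    exact ⟨⟨j, hji.trans i.2⟩, by simpa [Fin.lt_def] using hji, rfl⟩
  have hset : univ.erase (w (Fin.castLE hrn i)) =
      (univ.erase (Fin.castLE hrn i)).map w.toEmbedding := by
    ext k
    simp only [mem_erase, mem_univ, and_true, mem_map_equiv, ne_eq, Equiv.symm_apply_eq]
  have hsplit : univ.erase (Fin.castLE hrn i) =
      (Ioi (Fin.castLE hrn i)).disjUnion (Iio (Fin.castLE hrn i))
        (Finset.disjoint_left.2 fun k h1 h2 =>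
          lt_asymm (mem_Ioi.1 h1) (mem_Iio.1 h2)) := by
    ext k
    simp only [mem_erase, mem_univ, and_true, mem_disjUnion, mem_Ioi, mem_Iio]
    exact ne_iff_lt_or_gt.trans or_comm
  rw [hset, prod_map, hsplit, prod_disjUnion, hIio]
  rfl

open Polynomial in
/-- The coefficient of the generating function as a sum of iterated residues. -/
theorem coeff_generating_function {F : Type*} [Field F] {n r : ℕ} (hrn : r ≤ n)
    (v : Fin n → F) (hv : Function.Injective v) (β : ℕ → F) (lam : Fin r → ℕ)
    (y : Fin r → HahnSeries (Lex (Fin r → ℤ)) F)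
    (hy : ∀ i, y i = inVariable (Fin.rev i) (HahnSeries.single (-1 : ℤ) (1 : F))) :
    ((∏ i : Fin r, ((∏ j : Fin n, y i / (y i - HahnSeries.C (v j))) *
        (∏ j ∈ range (lam i + (n - 1 - (i : ℕ))), (y i + HahnSeries.C (β j)) / y i))) *
      (∏ i : Fin r, ∏ j ∈ Ioi i, (y j - y i) / y j)).coeff
        (toLex (fun k : Fin r => (lam (Fin.rev k) : ℤ))) =
    ∑ f : Fin r → Fin n, (∏ i, ∏ j ∈ range (lam i + (n - 1 - (i : ℕ))), (v (f i) + β j)) *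
      (∏ i : Fin r, ∏ j ∈ Ioi i, (v (f j) - v (f i))) /
      ∏ i, ∏ k ∈ univ.erase (f i), (v (f i) - v k) := by
  set P : Fin r → F[X] := fun i => ∏ j ∈ range (lam i + (n - 1 - (i : ℕ))), (X + C (β j)) with hP
  set G : Fin r → ℕ → HahnSeries ℤ F := fun i m =>
    (P i * X ^ m).eval₂ HahnSeries.C (HahnSeries.single (-1 : ℤ) (1 : F)) /
      (∏ j, (HahnSeries.single (-1 : ℤ) (1 : F) - HahnSeries.C (v j))) *
      HahnSeries.single ((lam i : ℤ) - 1) (1 : F) with hG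
  have hexp : (∏ i : Fin r, ((∏ j : Fin n, y i / (y i - HahnSeries.C (v j))) *
        (∏ j ∈ range (lam i + (n - 1 - (i : ℕ))), (y i + HahnSeries.C (β j)) / y i))) *
      (∏ i : Fin r, ∏ j ∈ Ioi i, (y j - y i) / y j) =
      ∑ σ : Equiv.Perm (Fin r), HahnSeries.C (Equiv.Perm.sign σ : F) *
        ∏ k, inVariable k (G (Fin.rev k) (σ (Fin.rev k))) := by
    rw [prod_Ioi_sub_div, mul_sum]
    refine sum_congr rfl fun σ _ => ?_
    rw [mul_left_comm, ← prod_mul_distrib, map_intCast]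
    congr 1
    refine Fintype.prod_equiv Fin.revPerm _ _ fun i => ?_
    rw [Fin.revPerm_apply, Fin.rev_rev, hG]
    simp only [hP]
    rw [← prod_div_mul_prod_div_mul_pow_div (N := lam i + (n - 1 - (i : ℕ))) (i := i) v β
      (by omega), hy]
    simp only [map_mul, map_prod, map_div₀, map_sub, map_add, map_pow, inVariable_C]
  have hcoeff : ∀ i m, (G i m).coeff (lam i) =
      ∑ k, (P i).eval (v k) / (∏ j ∈ univ.erase k, (v k - v j)) * v k ^ m := by
    intro i m
    rw [hG]
    simp only
    rw [HahnSeries.coeff_mul_single, mul_one, sub_sub_cancel, coeff_eval₂_div_prod_sub v hv]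
    refine sum_congr rfl fun k _ => ?_
    rw [eval_mul, eval_pow, eval_X]
    ring
  have hterm : ∀ σ : Equiv.Perm (Fin r),
      (∏ k, inVariable k (G (Fin.rev k) (σ (Fin.rev k)))).coeff
        (toLex (fun k : Fin r => (lam (Fin.rev k) : ℤ))) =
      ∑ f : Fin r → Fin n, (∏ i, (P i).eval (v (f i)) /
        (∏ j ∈ univ.erase (f i), (v (f i) - v j))) * ∏ i, v (f i) ^ (σ i : ℕ) := by
    intro σ
    rw [coeff_prod_inVariable]
    simp only [hcoeff]
    rw [← Fintype.prod_equiv Fin.revPerm (fun i => ∑ k, (P i).eval (v k) /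
      (∏ j ∈ univ.erase k, (v k - v j)) * v k ^ (σ i : ℕ)) _ (fun i => by simp),
      Fintype.prod_sum]
    simp only [prod_mul_distrib]
  rw [hexp, HahnSeries.coeff_sum]
  simp only [HahnSeries.C_mul_eq_smul, HahnSeries.coeff_smul, hterm, smul_eq_mul, mul_sum]
  rw [sum_comm]
  refine sum_congr rfl fun f _ => ?_
  rw [← Matrix.det_vandermonde fun i => v (f i), ← Matrix.det_transpose, Matrix.det_apply',
    mul_sum, sum_div]
  refine sum_congr rfl fun σ _ => ?_
  simp only [Matrix.transpose_apply, Matrix.vandermonde_apply, hP, prod_div_distrib, eval_prod,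
    eval_add, eval_X, eval_C]
  ring

end GeneratingFunction

theorem x_injective (n : ℕ) : Function.Injective (x n) := fun i j h => by
  have := MvPolynomial.X_injective (IsFractionRing.injective (MvPolynomial (Fin n ⊕ ℕ) ℚ) (K n) h)
  exact Sum.inl_injective this

/-- **Generating function for the factorial Schur polynomials (Kempf–Laksov type),
additive specialization.**

For a partition `λ_1 ≥ ⋯ ≥ λ_r > 0` of length `r ≤ n`, the factorial Schur polynomial
`s_λ(x_n|b) = Σ_{w ∈ C(r,n)} w·( ∏_{i=1}^r ∏_{j=1}^{λ_i−i+n} (x_i + b_j)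
  / ∏_{i=1}^r ∏_{j=i+1}^n (x_i − x_j) )`
equals the coefficient of `u_1^{−λ_1} ⋯ u_r^{−λ_r}` in
`∏_{i=1}^r ( ∏_{j=1}^n u_i/(u_i − x_j) · ∏_{j=1}^{λ_i−i+n} (u_i + b_j)/u_i )
  · ∏_{1≤i<j≤r} (u_j − u_i)/u_j`. -/
theorem factorial_schur_KL_generating_function
    (n r : ℕ) (hr : 1 ≤ r) (hrn : r ≤ n)
    (lam : Fin r → ℕ) (hpos : ∀ i, 0 < lam i)
    (hanti : ∀ i j : Fin r, i ≤ j → lam j ≤ lam i) :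
    (∑ w ∈ Cperm r n,
      (∏ i : Fin r, ∏ j ∈ Finset.range (lam i + (n - 1 - (i : ℕ))),
          (x n (w (Fin.castLE hrn i)) + b n j)) /
      (∏ i : Fin r, ∏ j ∈ Finset.Ioi (Fin.castLE hrn i),
          (x n (w (Fin.castLE hrn i)) - x n (w j))))
    =
    ((∏ i : Fin r,
        ((∏ j : Fin n, u n r i / (u n r i - HahnSeries.C (x n j))) *
         (∏ j ∈ Finset.range (lam i + (n - 1 - (i : ℕ))),
            (u n r i + HahnSeries.C (b n j)) / u n r i))) *
      (∏ i : Fin r, ∏ j ∈ Finset.Ioi i, (u n r j - u n r i) / u n r j)).coeff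
        (toLex (fun k : Fin r => (lam (Fin.rev k) : ℤ))) := by
  rw [coeff_generating_function hrn (x n) (x_injective n) (b n) lam (u n r)
    fun i => (inVariable_single _ _ _).symm]
  rw [← sum_Cperm_eq_sum_fun hrn]
  · refine sum_congr rfl fun w _ => ?_
    have hV : ∏ i : Fin r, ∏ j ∈ Ioi i,
        (x n (w (Fin.castLE hrn j)) - x n (w (Fin.castLE hrn i))) ≠ 0 := by
      refine prod_ne_zero_iff.2 fun i _ => prod_ne_zero_iff.2 fun j hj => sub_ne_zero.2 fun h => ?_
      exact (mem_Ioi.1 hj).ne' (Fin.castLE_injective hrn (w.injective (x_injective n h)))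
    rw [← prod_Ioi_sub_mul_prod_Iio_sub hrn (x n) w, mul_div_mul_right _ _ hV]
  · intro f hf
    rw [← Matrix.det_vandermonde fun i => x n (f i)]
    rw [Matrix.det_vandermonde_eq_zero_iff.2, mul_zero, zero_div]
    obtain ⟨i, j, h, hij⟩ := Function.not_injective_iff.1 hf
    exact ⟨i, j, congrArg (x n) h, hij⟩
end
end

section
/- Let ν = (ν_1 > ⋯ > ν_{2m} > 0) be a strict partition of even length 2m ≤ n and let Q_ν(x_n|b) := Σ_{w∈C(2m,n)} w·( ∏_{i=1}^{2m} 2x_i ∏_{j=1}^{ν_i−1} (x_i + b_j) · ∏_{i=1}^{2m} ∏_{j=i+1}^{n} (x_i + x_j)/(x_i − x_j) ) be the factorial Schur Q-polynomial, and for each pair i < j let Q_{(ν_i,ν_j)}(x_n|b) be defined by the same formula with the two-row strict partition (ν_i, ν_j) in place of ν (summing over C(2,n)). Then Ivanov's Pfaffian formula holds: Q_ν(x_n|b) = Pf( (Q_{(ν_i,ν_j)}(x_n|b))_{1≤i<j≤2m} ). -/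
open Finset

noncomputable section

/-- The factorial Schur `Q`-polynomial `Q_ν(x_n|b)` attached to a tuple
`ν = (ν_1, …, ν_r)`:
`Q_ν(x_n|b) = Σ_{w∈C(r,n)} w·( ∏_{i=1}^r 2x_i ∏_{j=1}^{ν_i−1} (x_i + b_j)
  · ∏_{i=1}^r ∏_{j=i+1}^n (x_i + x_j)/(x_i − x_j) )`. -/
def Qfact (n r : ℕ) (hrn : r ≤ n) (nu : Fin r → ℕ) : K n :=
  ∑ w ∈ Cperm r n,
    (∏ i : Fin r, (2 * x n (w (Fin.castLE hrn i)) *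
        ∏ j ∈ Finset.range (nu i - 1), (x n (w (Fin.castLE hrn i)) + b n j))) *
    (∏ i : Fin r, ∏ j ∈ Finset.Ioi (Fin.castLE hrn i),
        (x n (w (Fin.castLE hrn i)) + x n (w j)) /
        (x n (w (Fin.castLE hrn i)) - x n (w j)))

/-- The Pfaffian of a `2m × 2m` matrix over a commutative `ℚ`-algebra:
`Pf(A) := (1/(2^m m!)) Σ_{σ ∈ S_{2m}} sgn(σ) ∏_{i=1}^m A_{σ(2i−1), σ(2i)}`. -/
def pf {R : Type*} [CommRing R] [Algebra ℚ R] {m : ℕ}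
    (A : Matrix (Fin (2 * m)) (Fin (2 * m)) R) : R :=
  algebraMap ℚ R (((2 : ℚ) ^ m * (m.factorial : ℚ))⁻¹) *
    ∑ σ : Equiv.Perm (Fin (2 * m)),
      ((Equiv.Perm.sign σ : ℤ) : R) *
        ∏ i : Fin m, A (σ ⟨2 * (i : ℕ), by omega⟩) (σ ⟨2 * (i : ℕ) + 1, by omega⟩)

/-- The skew-symmetric kernel `(q - p) / (q + p)`. -/
def skewRatio {F : Type*} [Field F] (p q : F) : F := (q - p) / (q + p)

theorem skewRatio_swap {F : Type*} [Field F] (p q : F) : skewRatio p q = -skewRatio q p := by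
  unfold skewRatio
  rw [add_comm q p, ← neg_div, neg_sub]

theorem skewRatio_self {F : Type*} [Field F] (p : F) : skewRatio p p = 0 := by
  simp [skewRatio]

theorem prod_add_div_sub_eq {F ι : Type*} [Field F] [Fintype ι] [DecidableEq ι]
    {y : ι → F} (hy : Function.Injective y) {z : F} (hz : ∀ k, z ≠ y k) :
    ∏ k, (z + y k) / (z - y k) =
      1 + ∑ q, 2 * y q / (z - y q) * ∏ k ∈ univ.erase q, (y q + y k) / (y q - y k) := by
  have hd : ∏ k, (z - y k) ≠ 0 := prod_ne_zero_iff.2 fun k _ => sub_ne_zero.2 (hz k)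
  set f := Lagrange.nodal univ (fun k => -y k) - Lagrange.nodal univ y with hf
  have hdeg : f.degree < #(univ : Finset ι) := by
    rw [← Lagrange.degree_nodal (s := univ) (v := fun k => -y k)]
    apply Polynomial.degree_sub_lt_left
    · simp [Lagrange.degree_nodal]
    · exact Lagrange.nodal_monic.ne_zero
    · rw [Lagrange.nodal_monic.leadingCoeff, Lagrange.nodal_monic.leadingCoeff]
  have hint := Lagrange.eq_interpolate_of_eval_eq (fun q => f.eval (y q)) (hy.injOn) hdeg
    (fun _ _ => rfl)
  have hev := congrArg (Polynomial.eval z) hint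
  rw [Lagrange.eval_interpolate_not_at_node _ (fun k _ => hz k)] at hev
  have hfy : ∀ q, f.eval (y q) = 2 * y q * ∏ k ∈ univ.erase q, (y q + y k) := by
    intro q
    rw [hf, Polynomial.eval_sub, Lagrange.eval_nodal_at_node (mem_univ q), sub_zero,
      Lagrange.eval_nodal, ← mul_prod_erase _ _ (mem_univ q)]
    simp only [sub_neg_eq_add, two_mul]
  have hfz : f.eval z = ∏ k, (z + y k) - ∏ k, (z - y k) := by
    simp [hf, Lagrange.eval_nodal]
  rw [hfz, Lagrange.eval_nodal, sub_eq_iff_eq_add] at hev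
  rw [prod_div_distrib, hev, add_div, mul_div_cancel_left₀ _ hd, div_self hd, add_comm]
  congr 1
  refine sum_congr rfl fun q _ => ?_
  rw [hfy, Lagrange.nodalWeight, prod_inv_distrib, prod_div_distrib]
  simp only [div_eq_mul_inv]
  ring

theorem sum_skewRatio_mul_prod_inv {F ι : Type*} [Field F] [Fintype ι] [DecidableEq ι]
    (hcard : Odd (Fintype.card ι)) {y : ι → F} (hy : Function.Injective y)
    {z : F} (hz : ∀ k, y k + z ≠ 0) (hyy : ∀ k, y k + y k ≠ 0) :
    ∑ q, skewRatio z (y q) * ∏ k ∈ univ.erase q, (skewRatio (y q) (y k))⁻¹ =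
      ∏ k, skewRatio z (y k) := by
  have hA : ∀ q, ∏ k ∈ univ.erase q, (skewRatio (y q) (y k))⁻¹ =
      ∏ k ∈ univ.erase q, (y q + y k) / (y q - y k) := by
    intro q
    have he : Even #(univ.erase q) := by
      rw [card_erase_of_mem (mem_univ q), card_univ]
      exact Nat.Odd.sub_odd hcard odd_one
    rw [← one_mul (∏ k ∈ univ.erase q, (y q + y k) / (y q - y k)), ← he.neg_one_pow,
      ← prod_const, ← prod_mul_distrib]
    refine prod_congr rfl fun k _ => ?_
    rw [skewRatio, inv_div, ← neg_sub (y q), div_neg, add_comm (y k)]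
    ring
  have h0 := prod_add_div_sub_eq hy (z := 0) (fun k h => hyy k (by simp [← h]))
  have h1 := prod_add_div_sub_eq hy (z := -z)
    (fun k h => hz k (by simp [← h]))
  set A := fun q => ∏ k ∈ univ.erase q, (y q + y k) / (y q - y k)
  have h0' : ∏ k, (0 + y k) / (0 - y k) = -1 := by
    rw [← hcard.neg_one_pow, ← card_univ, ← prod_const]
    refine prod_congr rfl fun k _ => ?_
    have : y k ≠ 0 := fun h => hyy k (by simp [h])
    rw [zero_add, zero_sub, div_neg, div_self this]
  have h1' : ∏ k, (-z + y k) / (-z - y k) = -∏ k, skewRatio z (y k) := by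
    rw [neg_eq_neg_one_mul (∏ k, _), ← hcard.neg_one_pow, ← card_univ, ← prod_const,
      ← prod_mul_distrib]
    refine prod_congr rfl fun k _ => ?_
    rw [skewRatio, ← neg_add', div_neg, add_comm (-z), add_comm z, ← sub_eq_add_neg]
    ring
  rw [h0'] at h0
  rw [h1'] at h1
  obtain ⟨q₀⟩ : Nonempty ι := Fintype.card_pos_iff.1 hcard.pos
  have h2 : (2 : F) ≠ 0 := fun h => hyy q₀ (by rw [← two_mul, h, zero_mul])
  have h3 : ∑ q, skewRatio z (y q) * A q =
      -(∑ q, 2 * y q / (-z - y q) * A q) + 2⁻¹ * ∑ q, 2 * y q / (0 - y q) * A q := by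
    rw [← sum_neg_distrib, mul_sum, ← sum_add_distrib]
    refine sum_congr rfl fun q _ => ?_
    have h3 : y q ≠ 0 := fun h => hyy q (by simp [h])
    have h4 := hz q
    have h5 : -z - y q = -(y q + z) := by ring
    rw [h5, skewRatio]
    field_simp
    ring
  have h4 : ∑ q, 2 * y q / (0 - y q) * A q = -2 := by linear_combination -h0
  simp only [hA]
  rw [h3, h4]
  linear_combination h1 - mul_inv_cancel₀ h2

theorem sum_perm_succ {R α : Type*} [CommRing R] {N : ℕ} (x : Fin (N + 1) → α)
    (G : (Fin (N + 1) → α) → R) :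
    ∑ σ : Equiv.Perm (Fin (N + 1)), ((Equiv.Perm.sign σ : ℤ) : R) * G (x ∘ σ) =
      ∑ p, ((Equiv.Perm.sign (Equiv.swap 0 p) : ℤ) : R) *
        ∑ e : Equiv.Perm (Fin N), ((Equiv.Perm.sign e : ℤ) : R) *
          G (Fin.cons (x p) (Fin.tail (x ∘ Equiv.swap 0 p) ∘ e)) := by
  rw [← Equiv.sum_comp Equiv.Perm.decomposeFin.symm, Fintype.sum_prod_type]
  refine sum_congr rfl fun p _ => ?_
  rw [mul_sum]
  refine sum_congr rfl fun e _ => ?_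
  have : x ∘ Equiv.Perm.decomposeFin.symm (p, e) =
      Fin.cons (x p) (Fin.tail (x ∘ Equiv.swap 0 p) ∘ e) := by
    funext i
    refine Fin.cases ?_ (fun i => ?_) i
    · simp
    · simp [Fin.tail]
  rw [this, ← mul_assoc, Equiv.Perm.decomposeFin.symm_sign]
  congr 1
  by_cases hp : p = 0
  · simp [hp]
  · simp [hp, Equiv.Perm.sign_swap (Ne.symm hp)]

/-- The product `∏_{i<j} (x_j - x_i) / (x_j + x_i)`. -/
def schurProd {F : Type*} [Field F] {N : ℕ} (x : Fin N → F) : F :=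
  ∏ i, ∏ j ∈ Ioi i, skewRatio (x i) (x j)

theorem schurProd_comp_perm {F : Type*} [Field F] {N : ℕ} (x : Fin N → F)
    (σ : Equiv.Perm (Fin N)) :
    schurProd (x ∘ σ) = ((Equiv.Perm.sign σ : ℤ) : F) * schurProd x :=
  σ.prod_Ioi_comp_eq_sign_mul_prod (f := fun i j => skewRatio (x i) (x j))
    fun _ _ => skewRatio_swap _ _

theorem schurProd_succ {F : Type*} [Field F] {N : ℕ} (x : Fin (N + 1) → F) :
    schurProd x = (∏ k, skewRatio (x 0) (Fin.tail x k)) * schurProd (Fin.tail x) := by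
  simp [schurProd, Fin.prod_univ_succ, Fin.tail]

theorem schurProd_eq_zero {F : Type*} [Field F] {N : ℕ} {x : Fin N → F}
    (hx : ¬ Function.Injective x) : schurProd x = 0 := by
  simp only [Function.Injective, not_forall] at hx
  obtain ⟨i, j, hij, hne⟩ := hx
  wlog hlt : i < j generalizing i j
  · exact this j i hij.symm (Ne.symm hne) (lt_of_le_of_ne (not_lt.1 hlt) (Ne.symm hne))
  · exact prod_eq_zero (mem_univ i) (prod_eq_zero (mem_Ioi.2 hlt) (by rw [hij, skewRatio_self]))

theorem prod_erase_eq_prod_tail_swap {M α : Type*} [CommMonoid M] {N : ℕ} (y : Fin (N + 1) → α)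
    (q : Fin (N + 1)) (f : α → M) :
    ∏ k ∈ univ.erase q, f (y k) = ∏ k, f (Fin.tail (y ∘ Equiv.swap 0 q) k) := by
  have h : univ.erase q = (univ.map (Fin.succEmb N)).map (Equiv.swap 0 q).toEmbedding := by
    ext k
    rw [mem_map_equiv, Equiv.symm_swap, mem_map, mem_erase]
    simp [Fin.exists_succ_eq, Equiv.swap_apply_eq_iff]
  rw [h, prod_map, prod_map]
  rfl

theorem sum_sign_skewRatio_mul_schurProd {F : Type*} [Field F] {N : ℕ} (hN : Even N)
    {y : Fin (N + 1) → F} (hy : Function.Injective y) (hyy : ∀ k l, y k + y l ≠ 0)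
    {z : F} (hz : ∀ k, y k + z ≠ 0) :
    ∑ q, ((Equiv.Perm.sign (Equiv.swap 0 q) : ℤ) : F) *
        (skewRatio z (y q) * schurProd (Fin.tail (y ∘ Equiv.swap 0 q))) =
      schurProd (Fin.cons z y : Fin (N + 2) → F) := by
  rw [schurProd_succ, Fin.tail_cons, Fin.cons_zero,
    ← sum_skewRatio_mul_prod_inv (by simpa using hN.add_one) hy hz fun k => hyy k k, sum_mul]
  refine sum_congr rfl fun q _ => ?_
  have h1 := schurProd_comp_perm y (Equiv.swap 0 q)
  have h2 : ((Equiv.Perm.sign (Equiv.swap 0 q) : ℤ) : F) *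
      ((Equiv.Perm.sign (Equiv.swap 0 q) : ℤ) : F) = 1 := by
    rw [← Int.cast_mul, ← Units.val_mul, Int.units_mul_self]
    simp
  have h3 : ∏ k ∈ univ.erase q, skewRatio (y q) (y k) ≠ 0 := by
    refine prod_ne_zero_iff.2 fun k hk => div_ne_zero ?_ (hyy _ _)
    exact sub_ne_zero.2 (hy.ne (ne_of_mem_erase hk))
  rw [schurProd_succ, Function.comp_apply, Equiv.swap_apply_left,
    ← prod_erase_eq_prod_tail_swap y q (skewRatio (y q))] at h1
  rw [prod_inv_distrib]
  field_simp
  linear_combination skewRatio z (y q) * ((Equiv.Perm.sign (Equiv.swap 0 q) : ℤ) : F) * h1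
    + skewRatio z (y q) * schurProd y * h2

/-- The product of `skewRatio` over consecutive pairs of entries. -/
def pairProd {F : Type*} [Field F] {m : ℕ} (y : Fin (2 * m) → F) : F :=
  ∏ i : Fin m, skewRatio (y ⟨2 * (i : ℕ), by omega⟩) (y ⟨2 * (i : ℕ) + 1, by omega⟩)

theorem pairProd_cons_cons {F : Type*} [Field F] {m : ℕ} (p q : F) (y : Fin (2 * m) → F) :
    pairProd (m := m + 1) (Fin.cons p (Fin.cons q y : Fin (2 * m + 1) → F) : Fin (2 * m + 2) → F) =
      skewRatio p q * pairProd y := by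
  unfold pairProd
  rw [Fin.prod_univ_succ]
  rfl

theorem sum_sign_pairProd_of_injective {F : Type*} [Field F] {m : ℕ} {x : Fin (2 * m) → F}
    (hx : Function.Injective x) (hxx : ∀ k l, x k + x l ≠ 0) :
    ∑ σ : Equiv.Perm (Fin (2 * m)), ((Equiv.Perm.sign σ : ℤ) : F) * pairProd (x ∘ σ) =
      (2 ^ m * m.factorial : ℕ) * schurProd x := by
  induction m with
  | zero => simp [pairProd, schurProd]
  | succ m ih =>
    change Fin (2 * m + 1 + 1) → F at x
    change ∑ σ : Equiv.Perm (Fin (2 * m + 1 + 1)),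
      ((Equiv.Perm.sign σ : ℤ) : F) * pairProd (m := m + 1) (x ∘ σ) = _
    rw [sum_perm_succ x (pairProd (m := m + 1))]
    have key : ∀ p, ((Equiv.Perm.sign (Equiv.swap 0 p) : ℤ) : F) *
        ∑ e : Equiv.Perm (Fin (2 * m + 1)), ((Equiv.Perm.sign e : ℤ) : F) *
          pairProd (m := m + 1)
            (Fin.cons (x p) (Fin.tail (x ∘ Equiv.swap 0 p) ∘ e) : Fin (2 * m + 1 + 1) → F) =
        (2 ^ m * m.factorial : ℕ) * schurProd x := by
      intro p
      set y := Fin.tail (x ∘ Equiv.swap 0 p) with hy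
      have hyinj : Function.Injective y :=
        (hx.comp (Equiv.injective _)).comp (Fin.succ_injective _)
      rw [sum_perm_succ y (fun y => pairProd (m := m + 1) (Fin.cons (x p) y))]
      simp only [pairProd_cons_cons]
      have : ∀ q, ∑ e : Equiv.Perm (Fin (2 * m)), ((Equiv.Perm.sign e : ℤ) : F) *
          (skewRatio (x p) (y q) * pairProd (Fin.tail (y ∘ Equiv.swap 0 q) ∘ e)) =
          (2 ^ m * m.factorial : ℕ) *
            (skewRatio (x p) (y q) * schurProd (Fin.tail (y ∘ Equiv.swap 0 q))) := by
        intro q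
        rw [mul_left_comm, ← ih (x := Fin.tail (y ∘ Equiv.swap 0 q))
          ((hyinj.comp (Equiv.injective _)).comp (Fin.succ_injective _)) (fun _ _ => hxx _ _),
          mul_sum]
        exact sum_congr rfl fun _ _ => mul_left_comm _ _ _
      simp only [this, mul_left_comm _ ((2 ^ m * m.factorial : ℕ) : F)]
      rw [← mul_sum, sum_sign_skewRatio_mul_schurProd (even_two_mul m) hyinj
        (fun _ _ => hxx _ _) (fun _ => hxx _ _)]
      have hc : (Fin.cons (x p) y : Fin (2 * m + 2) → F) = x ∘ Equiv.swap 0 p := by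
        rw [hy]
        conv_rhs => rw [← Fin.cons_self_tail (x ∘ Equiv.swap 0 p)]
        simp
      rw [hc, schurProd_comp_perm, mul_left_comm, ← mul_assoc (((Equiv.Perm.sign _ : ℤ) : F)),
        ← Int.cast_mul, ← Units.val_mul, Int.units_mul_self]
      simp
    rw [sum_congr rfl fun p _ => key p, sum_const, card_univ, Fintype.card_fin, nsmul_eq_mul,
      Nat.factorial_succ]
    push_cast
    ring

theorem sum_sign_pairProd {F : Type*} [Field F] [CharZero F] {m : ℕ} {x : Fin (2 * m) → F}
    (hxx : ∀ k l, x k + x l ≠ 0) :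
    ∑ σ : Equiv.Perm (Fin (2 * m)), ((Equiv.Perm.sign σ : ℤ) : F) * pairProd (x ∘ σ) =
      (2 ^ m * m.factorial : ℕ) * schurProd x := by
  by_cases hx : Function.Injective x
  · exact sum_sign_pairProd_of_injective hx hxx
  rw [schurProd_eq_zero hx, mul_zero]
  simp only [Function.Injective, not_forall] at hx
  obtain ⟨i, j, hij, hne⟩ := hx
  have hs : x ∘ Equiv.swap i j = x := by
    funext k
    simp only [Function.comp_apply, Equiv.swap_apply_def]
    split_ifs with h1 h2
    · rw [h1, hij]
    · rw [h2, hij]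
    · rfl
  rw [← self_eq_neg (G := F), ← sum_neg_distrib, ← Equiv.sum_comp (Equiv.mulLeft (Equiv.swap i j))]
  refine sum_congr rfl fun σ _ => ?_
  rw [Equiv.coe_mulLeft, Equiv.Perm.sign_mul, Equiv.Perm.sign_swap hne, Equiv.Perm.coe_mul,
    ← Function.comp_assoc, hs]
  simp

theorem prod_fin_two_mul {M : Type*} [CommMonoid M] {m : ℕ} (f : Fin (2 * m) → M) :
    ∏ j, f j = ∏ i : Fin m, f ⟨2 * (i : ℕ), by omega⟩ * f ⟨2 * (i : ℕ) + 1, by omega⟩ := by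
  induction m with
  | zero => rfl
  | succ m ih =>
    change Fin (2 * m + 1 + 1) → M at f
    change ∏ j : Fin (2 * m + 1 + 1), f j = _
    rw [Fin.prod_univ_succ, Fin.prod_univ_succ, Fin.prod_univ_succ, ih, mul_assoc]
    rfl

/-- Functions on `Fin (2 * m)` as families of `m` consecutive pairs of values. -/
def pairsEquiv (m : ℕ) (ι : Type*) : (Fin m → ι × ι) ≃ (Fin (2 * m) → ι) where
  toFun p k := if (k : ℕ) % 2 = 0 then (p ⟨(k : ℕ) / 2, by omega⟩).1
    else (p ⟨(k : ℕ) / 2, by omega⟩).2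
  invFun c i := (c ⟨2 * (i : ℕ), by omega⟩, c ⟨2 * (i : ℕ) + 1, by omega⟩)
  left_inv p := by
    funext i
    have h : (2 * (i : ℕ) + 1) / 2 = i := by omega
    ext <;> simp [h]
  right_inv c := by
    funext k
    dsimp only
    split_ifs with h <;> congr 1 <;> ext <;> dsimp only <;> omega

theorem prod_sum_sum_eq_sum_prod_pairs {R ι : Type*} [CommRing R] [Fintype ι] {m : ℕ}
    (g : Fin m → ι → ι → R) :
    ∏ i, ∑ p, ∑ q, g i p q =
      ∑ c : Fin (2 * m) → ι,
        ∏ i : Fin m, g i (c ⟨2 * (i : ℕ), by omega⟩) (c ⟨2 * (i : ℕ) + 1, by omega⟩) := by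
  classical
  simp only [← Fintype.sum_prod_type' (f := g _)]
  rw [prod_univ_sum, Fintype.piFinset_univ, ← (pairsEquiv m ι).symm.sum_comp]
  rfl

theorem sum_sign_prod_sum_skewRatio {F ι : Type*} [Field F] [CharZero F] [Fintype ι] {m : ℕ}
    (h : Fin (2 * m) → ι → F) {X : ι → F} (hX : ∀ k l, X k + X l ≠ 0)
    (A : Matrix (Fin (2 * m)) (Fin (2 * m)) F)
    (hA : ∀ i j, A i j = ∑ p, ∑ q, h i p * h j q * skewRatio (X p) (X q)) :
    ∑ σ : Equiv.Perm (Fin (2 * m)), ((Equiv.Perm.sign σ : ℤ) : F) *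
        ∏ i : Fin m, A (σ ⟨2 * (i : ℕ), by omega⟩) (σ ⟨2 * (i : ℕ) + 1, by omega⟩) =
      (2 ^ m * m.factorial : ℕ) *
        ∑ a : Fin (2 * m) → ι, (∏ j, h j (a j)) * schurProd (X ∘ a) := by
  have key : ∀ σ : Equiv.Perm (Fin (2 * m)),
      ∏ i : Fin m, A (σ ⟨2 * (i : ℕ), by omega⟩) (σ ⟨2 * (i : ℕ) + 1, by omega⟩) =
        ∑ a : Fin (2 * m) → ι, (∏ j, h j (a j)) * pairProd ((X ∘ a) ∘ σ) := by
    intro σ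
    simp only [hA]
    rw [prod_sum_sum_eq_sum_prod_pairs (fun i p q => h (σ ⟨2 * (i : ℕ), by omega⟩) p *
      h (σ ⟨2 * (i : ℕ) + 1, by omega⟩) q * skewRatio (X p) (X q)),
      ← (Equiv.arrowCongr σ.symm (Equiv.refl ι)).sum_comp]
    refine sum_congr rfl fun a _ => ?_
    rw [prod_mul_distrib, ← Equiv.prod_comp σ (fun j => h j (a j)), prod_fin_two_mul]
    rfl
  simp only [key, mul_sum]
  rw [sum_comm]
  refine sum_congr rfl fun a _ => ?_
  rw [mul_left_comm, ← sum_sign_pairProd (x := X ∘ a) fun _ _ => hX _ _, mul_sum]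
  exact sum_congr rfl fun _ _ => mul_left_comm _ _ _

theorem prod_prod_Ioi_div_eq {F : Type*} [Field F] {n r : ℕ} (hrn : r ≤ n) {X : Fin n → F}
    (hinj : Function.Injective X) (hX : ∀ k l, X k + X l ≠ 0) (w : Equiv.Perm (Fin n)) :
    ∏ i : Fin r, ∏ j ∈ Ioi (Fin.castLE hrn i),
        (X (w (Fin.castLE hrn i)) + X (w j)) / (X (w (Fin.castLE hrn i)) - X (w j)) =
      (∏ i : Fin r, ∏ k ∈ univ.erase (w (Fin.castLE hrn i)),
        (X (w (Fin.castLE hrn i)) + X k) / (X (w (Fin.castLE hrn i)) - X k)) *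
        schurProd (X ∘ w ∘ Fin.castLE hrn) := by
  have h1 : schurProd (X ∘ w ∘ Fin.castLE hrn) = ∏ i : Fin r, ∏ j ∈ Iio i,
      skewRatio (X (w (Fin.castLE hrn j))) (X (w (Fin.castLE hrn i))) :=
    prod_comm' (by simp)
  have h2 : ∀ (i : Fin n) (f : Fin n → F), ∏ k ∈ univ.erase (w i), f k =
      (∏ j ∈ Iio i, f (w j)) * ∏ j ∈ Ioi i, f (w j) := by
    intro i f
    rw [← prod_union (by
      rw [disjoint_left]
      intro j hj hj'
      exact lt_asymm (mem_Iio.1 hj) (mem_Ioi.1 hj'))]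
    refine (prod_bij (fun j _ => w j) ?_ (fun _ _ _ _ h => w.injective h) ?_
      fun _ _ => rfl).symm
    · intro j hj
      simp only [mem_union, mem_Iio, mem_Ioi] at hj
      simpa using hj.elim (fun h => h.ne) (fun h => h.ne')
    · intro k hk
      refine ⟨w.symm k, ?_, by simp⟩
      have : w.symm k ≠ i := fun h => ne_of_mem_erase hk (by simp [← h])
      simpa using lt_or_gt_of_ne this
  rw [h1, ← prod_mul_distrib]
  refine prod_congr rfl fun i _ => ?_
  rw [h2, mul_right_comm, ← Fin.map_castLEEmb_Iio, prod_map, ← prod_mul_distrib]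
  rw [eq_comm]
  convert one_mul _
  refine prod_eq_one fun j hj => ?_
  have hne : w (Fin.castLE hrn i) ≠ w (Fin.castLE hrn j) := fun h =>
    (mem_Iio.1 hj).ne' (Fin.castLE_injective hrn (w.injective h))
  simp only [Fin.coe_castLEEmb, skewRatio]
  have h3 := sub_ne_zero.2 (hinj.ne hne)
  have h4 := hX (w (Fin.castLE hrn i)) (w (Fin.castLE hrn j))
  field_simp

theorem mem_Cperm {r n : ℕ} {w : Equiv.Perm (Fin n)} :
    w ∈ Cperm r n ↔ ∀ i j : Fin n, r ≤ (i : ℕ) → i < j → w i < w j := by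
  simp [Cperm]

theorem eq_of_mem_Cperm {r n : ℕ} (hrn : r ≤ n) {v w : Equiv.Perm (Fin n)} (hv : v ∈ Cperm r n)
    (hw : w ∈ Cperm r n) (h : v ∘ Fin.castLE hrn = w ∘ Fin.castLE hrn) : v = w := by
  rw [mem_Cperm] at hv hw
  obtain ⟨k, rfl⟩ := Nat.exists_eq_add_of_le hrn
  have hs : ∀ u : Equiv.Perm (Fin (r + k)),
      (∀ i j : Fin (r + k), r ≤ (i : ℕ) → i < j → u i < u j) → StrictMono (u ∘ Fin.natAdd r) :=
    fun u hu i j hij => hu _ _ (by simp) (by simpa using hij)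
  have hr : ∀ u : Equiv.Perm (Fin (r + k)), Set.range (u ∘ Fin.natAdd r) =
      (Set.range (u ∘ Fin.castLE hrn))ᶜ := by
    intro u
    ext y
    simp only [Set.mem_range, Set.mem_compl_iff, Function.comp_apply]
    obtain ⟨x, rfl⟩ := u.surjective y
    simp only [EmbeddingLike.apply_eq_iff_eq]
    refine Fin.addCases (fun i => ?_) (fun i => ?_) x
    · have h1 : ∀ j, Fin.natAdd r j ≠ Fin.castAdd k i := fun j h => by
        have := congrArg Fin.val h
        simp only [Fin.val_natAdd, Fin.val_castAdd] at this
        omega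
      simpa [h1] using ⟨i, rfl⟩
    · have h1 : ∀ j, Fin.castLE hrn j ≠ Fin.natAdd r i := fun j h => by
        have := congrArg Fin.val h
        simp only [Fin.val_natAdd, Fin.val_castLE] at this
        omega
      simp [h1]
  have h2 : v ∘ Fin.natAdd r = w ∘ Fin.natAdd r := by
    rw [← (hs v hv).range_inj (hs w hw), hr, hr, h]
  ext x
  refine Fin.addCases (fun i => ?_) (fun i => ?_) x
  · exact congrArg Fin.val (congrFun h i)
  · exact congrArg Fin.val (congrFun h2 i)

theorem exists_mem_Cperm_comp_castLE_eq {r n : ℕ} (hrn : r ≤ n) {a : Fin r → Fin n}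
    (ha : Function.Injective a) : ∃ w ∈ Cperm r n, w ∘ Fin.castLE hrn = a := by
  obtain ⟨k, rfl⟩ := Nat.exists_eq_add_of_le hrn
  have hc : #(univ.image a)ᶜ = k := by
    rw [card_compl, card_image_of_injective _ ha]
    simp
  set e := (univ.image a)ᶜ.orderEmbOfFin hc with he
  have hmem : ∀ i j, a i ≠ e j := by
    intro i j h
    have := (univ.image a)ᶜ.orderEmbOfFin_mem hc j
    rw [← he, ← h] at this
    simp at this
  have hinj : Function.Injective (Fin.append a e) :=
    Fin.append_injective_iff.2 ⟨ha, e.injective, hmem⟩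
  refine ⟨Equiv.ofBijective _ (Finite.injective_iff_bijective.1 hinj), ?_, ?_⟩
  · rw [mem_Cperm]
    intro i j
    refine Fin.addCases (fun i => ?_) (fun i => ?_) i
    · intro h
      simp at h
      omega
    · refine Fin.addCases (fun j => ?_) (fun j => ?_) j
      · intro _ h
        have := Fin.lt_def.1 h
        simp only [Fin.val_natAdd, Fin.val_castAdd] at this
        omega
      · intro _ h
        simpa using h
  · funext i
    exact Fin.append_left a e i

theorem sum_Cperm {M : Type*} [AddCommMonoid M] {r n : ℕ} (hrn : r ≤ n)
    (G : (Fin r → Fin n) → M) (hG : ∀ a, ¬ Function.Injective a → G a = 0) :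
    ∑ w ∈ Cperm r n, G (w ∘ Fin.castLE hrn) = ∑ a, G a := by
  classical
  rw [← sum_filter_of_ne (p := Function.Injective) fun a _ h => not_imp_comm.1 (hG a) h]
  refine sum_bij (fun w _ => w ∘ Fin.castLE hrn) ?_ ?_ ?_ fun _ _ => rfl
  · intro w _
    simpa using w.injective.comp (Fin.castLE_injective hrn)
  · exact fun v hv w hw h => eq_of_mem_Cperm hrn hv hw h
  · intro a ha
    obtain ⟨w, hw, h⟩ := exists_mem_Cperm_comp_castLE_eq hrn (mem_filter.1 ha).2
    exact ⟨w, hw, h⟩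

theorem x_add_x_ne_zero (n : ℕ) (i j : Fin n) : x n i + x n j ≠ 0 := by
  unfold x
  rw [← map_add]
  intro h
  rw [IsFractionRing.to_map_eq_zero_iff] at h
  have := congrArg (MvPolynomial.eval fun _ => (1 : ℚ)) h
  norm_num at this

/-- The weight of the variable `x_p` in the row of length `l`. -/
def rowWeight (n l : ℕ) (p : Fin n) : K n :=
  (2 * x n p * ∏ j ∈ range (l - 1), (x n p + b n j)) *
    ∏ k ∈ univ.erase p, (x n p + x n k) / (x n p - x n k)

theorem Qfact_eq_sum (n r : ℕ) (hrn : r ≤ n) (nu : Fin r → ℕ) :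
    Qfact n r hrn nu =
      ∑ a : Fin r → Fin n, (∏ i, rowWeight n (nu i) (a i)) * schurProd (x n ∘ a) := by
  rw [← sum_Cperm hrn]
  · refine sum_congr rfl fun w _ => ?_
    rw [prod_prod_Ioi_div_eq hrn (x_injective n) (x_add_x_ne_zero n), ← mul_assoc,
      ← prod_mul_distrib]
    rfl
  · intro a ha
    rw [schurProd_eq_zero fun h => ha (Function.Injective.of_comp h), mul_zero]

theorem Qfact_two_eq_sum (n : ℕ) (hn : 2 ≤ n) (k l : ℕ) :
    Qfact n 2 hn ![k, l] =
      ∑ p, ∑ q, rowWeight n k p * rowWeight n l q * skewRatio (x n p) (x n q) := by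
  rw [Qfact_eq_sum, ← (finTwoArrowEquiv (Fin n)).symm.sum_comp, Fintype.sum_prod_type]
  simp [schurProd, show Ioi (1 : Fin 2) = ∅ from rfl, show Ioi (0 : Fin 2) = {1} from rfl]

theorem sum_sum_rowWeight_swap (n k l : ℕ) :
    ∑ p, ∑ q, rowWeight n k p * rowWeight n l q * skewRatio (x n p) (x n q) =
      -∑ p, ∑ q, rowWeight n l p * rowWeight n k q * skewRatio (x n p) (x n q) := by
  rw [sum_comm, ← sum_neg_distrib]
  refine sum_congr rfl fun q _ => ?_
  rw [← sum_neg_distrib]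
  refine sum_congr rfl fun p _ => ?_
  rw [skewRatio_swap]
  ring

/-- **Ivanov's Pfaffian formula for the factorial Schur `Q`-polynomials.**

For a strict partition `ν_1 > ⋯ > ν_{2m} > 0` of even length `2m ≤ n`,
`Q_ν(x_n|b) = Pf( (Q_{(ν_i,ν_j)}(x_n|b))_{1≤i<j≤2m} )`,
the matrix being extended skew-symmetrically. -/
theorem ivanov_pfaffian_factorial_schur_Q
    (n m : ℕ) (hm : 1 ≤ m) (hmn : 2 * m ≤ n)
    (nu : Fin (2 * m) → ℕ) (hpos : ∀ i, 0 < nu i)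
    (hstrict : ∀ i j : Fin (2 * m), i < j → nu j < nu i) :
    Qfact n (2 * m) hmn nu =
    pf (Matrix.of fun i j : Fin (2 * m) =>
      if i < j then Qfact n 2 (le_trans (by omega) hmn) ![nu i, nu j]
      else if j < i then - Qfact n 2 (le_trans (by omega) hmn) ![nu j, nu i]
      else 0) := by
  rw [pf, Qfact_eq_sum, sum_sign_prod_sum_skewRatio (fun i p => rowWeight n (nu i) p)
    (x_add_x_ne_zero n), ← mul_assoc]
  · have h : (2 ^ m * m.factorial : ℚ) ≠ 0 := by positivity
    rw [← map_natCast (algebraMap ℚ (K n)), ← map_mul, Nat.cast_mul, Nat.cast_pow, Nat.cast_ofNat,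
      inv_mul_cancel₀ h, map_one, one_mul]
  · intro i j
    have h0 : ∀ k, ∑ p, ∑ q, rowWeight n k p * rowWeight n k q * skewRatio (x n p) (x n q) = 0 :=
      fun k => self_eq_neg.1 (sum_sum_rowWeight_swap n k k)
    rw [Matrix.of_apply]
    split_ifs with h1 h2
    · exact Qfact_two_eq_sum ..
    · rw [Qfact_two_eq_sum, ← sum_sum_rowWeight_swap]
    · rw [le_antisymm (not_lt.1 h2) (not_lt.1 h1), h0]
end
end
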